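/- Let π ∈ 𝒜 be a simple permutation of length n ≥ 4 with π(2) ≠ 1, let p = π⁻¹(1) be the position of its minimum, and let m be the position in {1,…,p−1} at which π attains its maximum over positions 1,…,p−1. Then π is strictly decreasing on positions m,…,p. -/

import Mathlib

/-- `σ` is contained in `π` as a pattern. -/
def Contains {k n : ℕ} (σ : Equiv.Perm (Fin k)) (π : Equiv.Perm (Fin n)) : Prop :=
  ∃ f : Fin k → Fin n, StrictMono f ∧ ∀ i j : Fin k, σ i < σ j ↔ π (f i) < π (f j)

/-- `π` avoids the pattern `σ`. -/
def Avoids {k n : ℕ} (σ : Equiv.Perm (Fin k)) (π : Equiv.Perm (Fin n)) : Prop :=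
  ¬ Contains σ π

/-- The permutation 4231 (0-indexed values). -/
noncomputable def p4231 : Equiv.Perm (Fin 4) := Equiv.ofBijective ![3,1,2,0] (by decide)

/-- The permutation 35142 (0-indexed values). -/
noncomputable def p35142 : Equiv.Perm (Fin 5) := Equiv.ofBijective ![2,4,0,3,1] (by decide)

/-- The permutation 42513 (0-indexed values). -/
noncomputable def p42513 : Equiv.Perm (Fin 5) := Equiv.ofBijective ![3,1,4,0,2] (by decide)

/-- The permutation 351624 (0-indexed values). -/
noncomputable def p351624 : Equiv.Perm (Fin 6) := Equiv.ofBijective ![2,4,0,5,1,3] (by decide)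

/-- Membership in the class 𝒜 = Av(4231, 35142, 42513, 351624). -/
def InA {n : ℕ} (π : Equiv.Perm (Fin n)) : Prop :=
  Avoids p4231 π ∧ Avoids p35142 π ∧ Avoids p42513 π ∧ Avoids p351624 π

/-- `s` is an interval of `π`: a set of consecutive positions whose image
under `π` is a set of consecutive values. -/
def IsPermInterval {n : ℕ} (π : Equiv.Perm (Fin n)) (s : Finset (Fin n)) : Prop :=
  (∀ a ∈ s, ∀ b ∈ s, ∀ j : Fin n, a ≤ j → j ≤ b → j ∈ s) ∧
  (∀ a ∈ s, ∀ b ∈ s, ∀ j : Fin n, π a ≤ π j → π j ≤ π b → j ∈ s)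

/-- `π` is simple: its only intervals are singletons (or empty) and the whole domain. -/
def IsSimple {n : ℕ} (π : Equiv.Perm (Fin n)) : Prop :=
  ∀ s : Finset (Fin n), IsPermInterval π s → s.card ≤ 1 ∨ s = Finset.univ

/-- The reverse complement of a permutation. -/
def revComp {n : ℕ} (π : Equiv.Perm (Fin n)) : Equiv.Perm (Fin n) :=
  (Fin.revPerm.trans π).trans Fin.revPerm

/-- The skew sum `σ ⊖ τ`. -/
def skewSum {m k : ℕ} (σ : Equiv.Perm (Fin m)) (τ : Equiv.Perm (Fin k)) :
    Equiv.Perm (Fin (m + k)) :=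
  finSumFinEquiv.symm.trans ((Equiv.sumCongr σ τ).trans
    ((Equiv.sumComm (Fin m) (Fin k)).trans (finSumFinEquiv.trans (finCongr (Nat.add_comm k m)))))

/-- The direct sum `α ⊕ β`. -/
def directSum {m k : ℕ} (α : Equiv.Perm (Fin m)) (β : Equiv.Perm (Fin k)) :
    Equiv.Perm (Fin (m + k)) :=
  finSumFinEquiv.symm.trans ((Equiv.sumCongr α β).trans finSumFinEquiv)

/-- The permutation 312 (0-indexed values). -/
noncomputable def p312 : Equiv.Perm (Fin 3) := Equiv.ofBijective ![2,0,1] (by decide)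

/-- The permutation 231 (0-indexed values). -/
noncomputable def p231 : Equiv.Perm (Fin 3) := Equiv.ofBijective ![1,2,0] (by decide)

/-- The number of simple permutations of length `n` in the class 𝒜. -/
noncomputable def simpleCount (n : ℕ) : ℕ :=
  Nat.card {π : Equiv.Perm (Fin n) // IsSimple π ∧ InA π}

/-- Four positions whose values are in the relative order of 4231 form an occurrence of it. -/
theorem contains_p4231 {n : ℕ} {π : Equiv.Perm (Fin n)} {a b c d : Fin n}
    (hab : a < b) (hbc : b < c) (hcd : c < d)
    (hdb : π d < π b) (hbc' : π b < π c) (hca : π c < π a) : Contains p4231 π := by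
  refine ⟨![a, b, c, d], ?_, ?_⟩
  · rw [Fin.strictMono_iff_lt_succ]
    intro i
    fin_cases i <;> simpa
  · intro i j
    fin_cases i <;> fin_cases j <;> simp [p4231, Equiv.ofBijective_apply] <;> order

theorem statement_12 {n : ℕ} (hn : 4 ≤ n) (π : Equiv.Perm (Fin n))
    (hsimple : IsSimple π) (hA : InA π) (h2 : π ⟨1, by omega⟩ ≠ ⟨0, by omega⟩)
    (p m : Fin n) (hp : p = π⁻¹ ⟨0, by omega⟩) (hmp : m < p)
    (hmax : ∀ i : Fin n, i < p → π i ≤ π m) :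
    ∀ i j : Fin n, m ≤ i → i < j → j ≤ p → π j < π i := by
  intro i j hmi hij hjp
  by_contra hle
  have hlt : π i < π j := lt_of_le_of_ne (not_lt.mp hle) (π.injective.ne hij.ne)
  have hpos : ∀ x : Fin n, x ≠ p → π p < π x := by
    intro x hx
    refine lt_of_le_of_ne ?_ (π.injective.ne hx.symm)
    have hp0 : π p = ⟨0, by omega⟩ := by simp [hp]
    rw [hp0]
    exact Nat.zero_le _
  have hjp' : j < p := lt_of_le_of_ne hjp fun h =>
    (h ▸ hlt).not_gt (hpos i (hij.trans_le hjp).ne)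
  have hmi' : m < i := lt_of_le_of_ne hmi fun h => (h ▸ hlt).not_ge (hmax j hjp')
  exact hA.1 (contains_p4231 hmi' hij hjp' (hpos i (hij.trans hjp').ne) hlt
    (lt_of_le_of_ne (hmax j hjp') (π.injective.ne (hmi'.trans hij).ne')))
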